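/- arXiv:1512.07338 — 4 statements merged into one kernel-verified Lean document; each statement's English description precedes it below -/
import Mathlib

section
/- For every integer k ≥ 1, N(5+2k) ≥ 20·3^k; that is, there exists an FC-algorithm in 5+2k weighings for 20·3^k coins. -/
/-- An adaptive strategy for balance weighings on `N` coins: a ternary decision
tree.  At a `weigh A B` node the sets `A` and `B` are placed on the two pans,
and the strategy branches on the outcome (`.lt`: left pan lighter, `.eq`:
balance, `.gt`: right pan lighter).  A leaf `output S` outputs the set `S` of
coins. -/
inductive FCTree (N : ℕ) : Type
  | output (S : Finset (Fin N)) : FCTree N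
  | weigh (A B : Finset (Fin N)) (child : Ordering → FCTree N) : FCTree N

namespace FCTree

/-- The depth (number of weighings in the worst case) of a strategy. -/
def depth {N : ℕ} : FCTree N → ℕ
  | output _ => 0
  | weigh _ _ child =>
      1 + max (depth (child .lt)) (max (depth (child .eq)) (depth (child .gt)))

/-- A strategy is well-formed if in every weighing the two pans are disjoint. -/
def WF {N : ℕ} : FCTree N → Prop
  | output _ => True
  | weigh A B child => Disjoint A B ∧ ∀ o, WF (child o)

end FCTree

/-- Weight of coin `x` when `f` is the fake coin, `c` is the chameleon, and the
chameleon chooses to weigh as a fake coin iff `b = true`.  Real coins weigh `1`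
and the (lighter) fake coin weighs `0`. -/
def coinWeight {N : ℕ} (f c : Fin N) (b : Bool) (x : Fin N) : ℕ :=
  if x = f then 0 else if x = c ∧ b = true then 0 else 1

/-- The outcome of weighing pan `A` against pan `B`, with fake `f`, chameleon
`c`, and chameleon choice `b`. -/
def weighOutcome {N : ℕ} (f c : Fin N) (b : Bool) (A B : Finset (Fin N)) : Ordering :=
  compare (∑ x ∈ A, coinWeight f c b x) (∑ x ∈ B, coinWeight f c b x)

/-- `Reaches f c t S` holds if, with fake coin `f` and chameleon `c`, some
sequence of choices by the chameleon (one choice before each weighing,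
independently) leads the strategy `t` to output the set `S`. -/
inductive Reaches {N : ℕ} (f c : Fin N) : FCTree N → Finset (Fin N) → Prop
  | output (S : Finset (Fin N)) : Reaches f c (.output S) S
  | weigh (A B : Finset (Fin N)) (child : Ordering → FCTree N) (b : Bool)
      (S : Finset (Fin N)) :
      Reaches f c (child (weighOutcome f c b A B)) S →
      Reaches f c (.weigh A B child) S

/-- `t` is an FC-solution for `N` coins in `w` weighings: a well-formed strategy
of depth at most `w` which, for every placement of the fake coin and the
chameleon and every sequence of choices by the chameleon, outputs a set of at
most 2 coins containing the fake coin. -/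
def IsFCSolution {N : ℕ} (t : FCTree N) (w : ℕ) : Prop :=
  t.WF ∧ t.depth ≤ w ∧
    ∀ f c : Fin N, f ≠ c → ∀ S, Reaches f c t S → S.card ≤ 2 ∧ f ∈ S

/-- There is an FC-algorithm in `w` weighings for `N` coins. -/
def FCAlgorithm (N w : ℕ) : Prop := ∃ t : FCTree N, IsFCSolution t w

/-- `FC N` is the least number of weighings `w` for which an FC-algorithm in
`w` weighings for `N` coins exists. -/
noncomputable def FC (N : ℕ) : ℕ := sInf {w | FCAlgorithm N w}

/-- Weight of coin `x` in the FF-problem with fake coins `f₁` and `f₂`. -/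
def ffWeight {N : ℕ} (f₁ f₂ x : Fin N) : ℕ := if x = f₁ ∨ x = f₂ then 0 else 1

/-- The (deterministic) run of a strategy in the FF-problem with fake coins
`f₁` and `f₂`; it returns the output set. -/
def ffRun {N : ℕ} (f₁ f₂ : Fin N) : FCTree N → Finset (Fin N)
  | .output S => S
  | .weigh A B child =>
      ffRun f₁ f₂
        (child (compare (∑ x ∈ A, ffWeight f₁ f₂ x) (∑ x ∈ B, ffWeight f₁ f₂ x)))

/-- There is an FF-algorithm in `w` weighings for `N` coins: a well-formed
strategy of depth at most `w` that identifies both fake coins for every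
placement of the two fake coins. -/
def FFAlgorithm (N w : ℕ) : Prop :=
  ∃ t : FCTree N, t.WF ∧ t.depth ≤ w ∧
    ∀ f₁ f₂ : Fin N, f₁ ≠ f₂ → ffRun f₁ f₂ t = {f₁, f₂}

/-- The group (of three coins) to which a coin of the scaled problem belongs. -/
def coinGroup {N : ℕ} (x : Fin (3 * N)) : Fin N :=
  ⟨x.val / 3, by have := x.isLt; omega⟩

/-- The set of coins of the scaled problem whose group lies in `A`. -/
def expandPan {N : ℕ} (A : Finset (Fin N)) : Finset (Fin (3 * N)) :=
  Finset.univ.filter (fun x => coinGroup x ∈ A)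

/-- The scaling of a strategy, extended at the leaves: every coin is replaced
by a group of three coins, every weighing is performed on the corresponding
groups, and every leaf `output S` is replaced by the strategy `ext S`. -/
def scaleExtend {N : ℕ} (ext : Finset (Fin N) → FCTree (3 * N)) :
    FCTree N → FCTree (3 * N)
  | .output S => ext S
  | .weigh A B child =>
      .weigh (expandPan A) (expandPan B) (fun o => scaleExtend ext (child o))

/-- A `(w,N)`-solution `t` is scalable if its scaling can be extended by (at
most) two further weighings at each leaf to a `(w+2, 3N)`-solution. -/
def IsScalable {N : ℕ} (t : FCTree N) (w : ℕ) : Prop :=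
  ∃ ext : Finset (Fin N) → FCTree (3 * N),
    (∀ S, (ext S).WF ∧ (ext S).depth ≤ 2) ∧
    IsFCSolution (scaleExtend ext t) (w + 2)

namespace FCTree

/-- A strategy is balanced if the two pans of every weighing hold equally many coins. -/
def Balanced {N : ℕ} : FCTree N → Prop
  | output _ => True
  | weigh A B child => A.card = B.card ∧ ∀ o, Balanced (child o)

end FCTree

/-- A balanced FC-solution that, on the run without chameleon (encoded by `Reaches f f`),
outputs exactly the fake coin. -/
structure IsStrongSolution {N : ℕ} (t : FCTree N) (w : ℕ) : Prop where
  wf : t.WF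
  balanced : t.Balanced
  depth_le : t.depth ≤ w
  card_le : ∀ f c S, Reaches f c t S → S.card ≤ 2
  mem : ∀ f c S, Reaches f c t S → f ∈ S
  eq_singleton : ∀ f S, Reaches f f t S → S = {f}

theorem IsStrongSolution.isFCSolution {N w : ℕ} {t : FCTree N} (h : IsStrongSolution t w) :
    IsFCSolution t w :=
  ⟨h.wf, h.depth_le, fun f c _ S hS => ⟨h.card_le f c S hS, h.mem f c S hS⟩⟩

theorem reaches_output_iff {N : ℕ} {f c : Fin N} {S T : Finset (Fin N)} :
    Reaches f c (.output T) S ↔ S = T := by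
  constructor
  · rintro ⟨⟩
    rfl
  · rintro rfl
    exact .output S

theorem reaches_weigh_iff {N : ℕ} {f c : Fin N} {A B S : Finset (Fin N)}
    {child : Ordering → FCTree N} :
    Reaches f c (.weigh A B child) S ↔
      ∃ b, Reaches f c (child (weighOutcome f c b A B)) S := by
  constructor
  · rintro (_ | ⟨_, _, _, b, _, h⟩)
    exact ⟨b, h⟩
  · rintro ⟨b, h⟩
    exact .weigh A B child b S h

/-- The total weight missing from the pan `A`. -/
def deficit {N : ℕ} (f c : Fin N) (b : Bool) (A : Finset (Fin N)) : ℕ :=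
  (if f ∈ A then 1 else 0) + (if c ≠ f ∧ b = true ∧ c ∈ A then 1 else 0)

theorem sum_coinWeight_add_deficit {N : ℕ} (f c : Fin N) (b : Bool) (A : Finset (Fin N)) :
    ∑ x ∈ A, coinWeight f c b x + deficit f c b A = A.card := by
  have hf : (if f ∈ A then 1 else 0) = ∑ x ∈ A, if x = f then 1 else 0 := by
    rw [Finset.sum_ite_eq' A f]
  have hc : (if c ≠ f ∧ b = true ∧ c ∈ A then 1 else 0) =
      ∑ x ∈ A, if x = c then (if c ≠ f ∧ b = true then 1 else 0) else 0 := by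
    rw [Finset.sum_ite_eq' A c]
    by_cases h : c ∈ A <;> simp [h]
  rw [deficit, hf, hc, ← Finset.sum_add_distrib, ← Finset.sum_add_distrib,
    Finset.card_eq_sum_ones]
  refine Finset.sum_congr rfl fun x _ => ?_
  unfold coinWeight
  by_cases h1 : x = f
  · by_cases h2 : x = c
    · subst h1 h2
      simp
    · simp [h1, show f ≠ c from h1 ▸ h2]
  · by_cases h2 : x = c
    · subst h2
      cases b <;> simp [h1]
    · simp [h1, h2]

theorem weighOutcome_eq_compare_deficit {N : ℕ} (f c : Fin N) (b : Bool)
    {A B : Finset (Fin N)} (h : A.card = B.card) :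
    weighOutcome f c b A B = compare (deficit f c b B) (deficit f c b A) := by
  have hA := sum_coinWeight_add_deficit f c b A
  have hB := sum_coinWeight_add_deficit f c b B
  unfold weighOutcome
  rcases lt_trichotomy (deficit f c b B) (deficit f c b A) with hlt | heq | hgt
  · rw [compare_lt_iff_lt.2 hlt, compare_lt_iff_lt]
    omega
  · rw [compare_eq_iff_eq.2 heq, compare_eq_iff_eq]
    omega
  · rw [compare_gt_iff_gt.2 hgt, compare_gt_iff_gt]
    omega

section Scaling

variable {N : ℕ}

/-- The `i`-th coin of the group `a`. -/
def groupCoin (a : Fin N) (i : Fin 3) : Fin (3 * N) :=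
  ⟨3 * a.val + i.val, by omega⟩

theorem coinGroup_groupCoin (a : Fin N) (i : Fin 3) : coinGroup (groupCoin a i) = a := by
  ext
  simp only [coinGroup, groupCoin]
  omega

theorem groupCoin_inj {a b : Fin N} {i j : Fin 3} :
    groupCoin a i = groupCoin b j ↔ a = b ∧ i = j := by
  simp only [groupCoin, Fin.ext_iff]
  omega

theorem exists_eq_groupCoin (x : Fin (3 * N)) : ∃ a i, x = groupCoin a i :=
  ⟨coinGroup x, ⟨x.val % 3, Nat.mod_lt _ (by norm_num)⟩, by
    ext
    simp only [coinGroup, groupCoin]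
    omega⟩

theorem mem_expandPan {A : Finset (Fin N)} {x : Fin (3 * N)} :
    x ∈ expandPan A ↔ coinGroup x ∈ A := by
  simp [expandPan]

theorem disjoint_expandPan {A B : Finset (Fin N)} (h : Disjoint A B) :
    Disjoint (expandPan A) (expandPan B) := by
  rw [Finset.disjoint_left] at h ⊢
  intro x hA hB
  exact h (mem_expandPan.1 hA) (mem_expandPan.1 hB)

theorem card_expandPan (A : Finset (Fin N)) : (expandPan A).card = 3 * A.card := by
  have h : expandPan A = (A ×ˢ (Finset.univ : Finset (Fin 3))).image
      (fun p => groupCoin p.1 p.2) := by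
    ext x
    obtain ⟨a, i, rfl⟩ := exists_eq_groupCoin x
    simp [mem_expandPan, coinGroup_groupCoin, groupCoin_inj]
  rw [h, Finset.card_image_of_injective, Finset.card_product, Finset.card_univ, Fintype.card_fin,
    mul_comm]
  rintro ⟨a, i⟩ ⟨b, j⟩ hab
  simpa [groupCoin_inj] using hab

theorem weighOutcome_expandPan (f c : Fin (3 * N)) (b : Bool) {A B : Finset (Fin N)}
    (hd : Disjoint A B) (h : A.card = B.card) :
    weighOutcome f c b (expandPan A) (expandPan B) =
      weighOutcome (coinGroup f) (coinGroup c) b A B := by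
  rw [weighOutcome_eq_compare_deficit _ _ _ (by rw [card_expandPan, card_expandPan, h]),
    weighOutcome_eq_compare_deficit _ _ _ h]
  unfold deficit
  simp only [mem_expandPan]
  by_cases hg : coinGroup c = coinGroup f
  · have hAB : coinGroup f ∈ A → coinGroup f ∉ B := fun hA => Finset.disjoint_left.1 hd hA
    by_cases hA : coinGroup f ∈ A <;> by_cases hB : coinGroup f ∈ B <;>
      by_cases hc : c = f <;> cases b <;> simp_all <;> rfl
  · have hc : c ≠ f := fun hc => hg (congrArg _ hc)
    simp [hg, hc]

theorem exists_reaches_of_reaches_scaleExtend {ext : Finset (Fin N) → FCTree (3 * N)}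
    {f c : Fin (3 * N)} {S : Finset (Fin (3 * N))} (t : FCTree N) (hwf : t.WF)
    (hb : t.Balanced) (h : Reaches f c (scaleExtend ext t) S) :
    ∃ T, Reaches (coinGroup f) (coinGroup c) t T ∧ Reaches f c (ext T) S := by
  induction t with
  | output T => exact ⟨T, .output T, h⟩
  | weigh A B child ih =>
    obtain ⟨b, h⟩ := reaches_weigh_iff.1 h
    rw [weighOutcome_expandPan f c b hwf.1 hb.1] at h
    obtain ⟨T, hT, hS⟩ := ih _ (hwf.2 _) (hb.2 _) h
    exact ⟨T, .weigh A B child b T hT, hS⟩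

theorem wf_scaleExtend {ext : Finset (Fin N) → FCTree (3 * N)} (hext : ∀ S, (ext S).WF)
    (t : FCTree N) (h : t.WF) : (scaleExtend ext t).WF := by
  induction t with
  | output T => exact hext T
  | weigh A B child ih => exact ⟨disjoint_expandPan h.1, fun o => ih o (h.2 o)⟩

theorem balanced_scaleExtend {ext : Finset (Fin N) → FCTree (3 * N)}
    (hext : ∀ S, (ext S).Balanced) (t : FCTree N) (h : t.Balanced) :
    (scaleExtend ext t).Balanced := by
  induction t with
  | output T => exact hext T
  | weigh A B child ih =>
    exact ⟨by rw [card_expandPan, card_expandPan, h.1], fun o => ih o (h.2 o)⟩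

theorem depth_scaleExtend_le {ext : Finset (Fin N) → FCTree (3 * N)} {d : ℕ}
    (hext : ∀ S, (ext S).depth ≤ d) (t : FCTree N) :
    (scaleExtend ext t).depth ≤ t.depth + d := by
  induction t with
  | output T => simpa [scaleExtend, FCTree.depth] using hext T
  | weigh A B child ih =>
    have h1 := ih .lt
    have h2 := ih .eq
    have h3 := ih .gt
    simp only [scaleExtend, FCTree.depth]
    omega

/-- The strategy that weighs the single coin `x` against the single coin `y`. -/
def weighCoins {M : ℕ} (x y : Fin M) (l e g : FCTree M) : FCTree M :=
  .weigh {x} {y} fun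
    | .lt => l
    | .eq => e
    | .gt => g

theorem reaches_weighCoins_iff {M : ℕ} {f c x y : Fin M} {l e g : FCTree M}
    {S : Finset (Fin M)} :
    Reaches f c (weighCoins x y l e g) S ↔ ∃ b,
      (coinWeight f c b x < coinWeight f c b y ∧ Reaches f c l S) ∨
      (coinWeight f c b x = coinWeight f c b y ∧ Reaches f c e S) ∨
      (coinWeight f c b y < coinWeight f c b x ∧ Reaches f c g S) := by
  rw [weighCoins, reaches_weigh_iff]
  refine exists_congr fun b => ?_
  simp only [weighOutcome, Finset.sum_singleton]
  rcases lt_trichotomy (coinWeight f c b x) (coinWeight f c b y) with h | h | h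
  · rw [compare_lt_iff_lt.2 h]
    simp [h, h.ne, h.not_gt]
  · rw [compare_eq_iff_eq.2 h]
    simp [h]
  · rw [compare_gt_iff_gt.2 h]
    simp [h, h.ne', h.not_gt]

/-- Two weighings that find the fake coin inside the group `a`. -/
def splitOne (a : Fin N) : FCTree (3 * N) :=
  weighCoins (groupCoin a 0) (groupCoin a 1)
    (weighCoins (groupCoin a 0) (groupCoin a 2) (.output {groupCoin a 0})
      (.output {groupCoin a 0, groupCoin a 2}) (.output {groupCoin a 2}))
    (weighCoins (groupCoin a 0) (groupCoin a 2) (.output {groupCoin a 0, groupCoin a 1})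
      (.output {groupCoin a 1, groupCoin a 2}) (.output {groupCoin a 2}))
    (weighCoins (groupCoin a 1) (groupCoin a 2) (.output {groupCoin a 1})
      (.output {groupCoin a 1, groupCoin a 2}) (.output {groupCoin a 2}))

/-- One weighing that selects a coin of the group `b`, to be output together with `x`. -/
def selectPartner (x : Fin (3 * N)) (b : Fin N) : FCTree (3 * N) :=
  weighCoins (groupCoin b 0) (groupCoin b 1) (.output {x, groupCoin b 0})
    (.output {x, groupCoin b 2}) (.output {x, groupCoin b 1})

/-- Two weighings that select one coin from each of the groups `a` and `b`. -/
def splitTwo (a b : Fin N) : FCTree (3 * N) :=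
  weighCoins (groupCoin a 0) (groupCoin a 1) (selectPartner (groupCoin a 0) b)
    (selectPartner (groupCoin a 2) b) (selectPartner (groupCoin a 1) b)

theorem splitOne_spec {f c : Fin (3 * N)} {S : Finset (Fin (3 * N))}
    (h : Reaches f c (splitOne (coinGroup f)) S) :
    S.card ≤ 2 ∧ f ∈ S ∧ (c = f → S = {f}) := by
  obtain ⟨a, i, rfl⟩ := exists_eq_groupCoin f
  obtain ⟨a', j, rfl⟩ := exists_eq_groupCoin c
  rw [coinGroup_groupCoin] at h
  simp only [splitOne, reaches_weighCoins_iff, reaches_output_iff, coinWeight, groupCoin_inj,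
    Bool.exists_bool] at h
  by_cases ha : a = a'
  · subst ha
    fin_cases i <;> fin_cases j <;> simp at h ⊢ <;>
      (first | (subst h) | (rcases h with rfl | rfl) |
        (rcases h with (rfl | rfl) | rfl) | (rcases h with (rfl | rfl) | (rfl | rfl))) <;>
      simp [groupCoin_inj]
  · fin_cases i <;> simp [ha] at h ⊢ <;> subst h <;> simp [groupCoin_inj, Ne.symm ha]

theorem selectPartner_spec {b : Fin N} {f c x : Fin (3 * N)} {S : Finset (Fin (3 * N))}
    (h : Reaches f c (selectPartner x b) S) :
    S.card ≤ 2 ∧ x ∈ S ∧ (coinGroup f = b → coinGroup c ≠ b → f ∈ S) := by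
  simp only [selectPartner, reaches_weighCoins_iff, reaches_output_iff] at h
  refine ⟨?_, ?_, ?_⟩
  · obtain ⟨_, ⟨_, rfl⟩ | ⟨_, rfl⟩ | ⟨_, rfl⟩⟩ := h <;> exact Finset.card_le_two
  · obtain ⟨_, ⟨_, rfl⟩ | ⟨_, rfl⟩ | ⟨_, rfl⟩⟩ := h <;> simp
  · obtain ⟨b', i, rfl⟩ := exists_eq_groupCoin f
    obtain ⟨c', j, rfl⟩ := exists_eq_groupCoin c
    simp only [coinGroup_groupCoin]
    rintro rfl hc
    simp only [coinWeight, groupCoin_inj, Bool.exists_bool] at h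
    fin_cases i <;> simp [hc.symm] at h ⊢ <;> simp [h]

theorem splitTwo_spec {a b : Fin N} {f c : Fin (3 * N)} {S : Finset (Fin (3 * N))} (hab : a ≠ b)
    (hf : coinGroup f = a ∨ coinGroup f = b) (hc : coinGroup c ≠ coinGroup f)
    (h : Reaches f c (splitTwo a b) S) : S.card ≤ 2 ∧ f ∈ S := by
  rw [splitTwo, reaches_weighCoins_iff] at h
  have hsel : ∃ x, Reaches f c (selectPartner x b) S := by
    obtain ⟨_, ⟨_, h⟩ | ⟨_, h⟩ | ⟨_, h⟩⟩ := h <;> exact ⟨_, h⟩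
  obtain ⟨x, hx⟩ := hsel
  refine ⟨(selectPartner_spec hx).1, ?_⟩
  rcases hf with hf | rfl
  · obtain ⟨a', i, rfl⟩ := exists_eq_groupCoin f
    obtain ⟨c', j, rfl⟩ := exists_eq_groupCoin c
    simp only [coinGroup_groupCoin] at hf hc
    subst hf
    simp only [coinWeight, groupCoin_inj] at h
    fin_cases i <;> simp [hc.symm] at h ⊢ <;> exact (selectPartner_spec h).2.1
  · exact (selectPartner_spec hx).2.2 rfl hc

open Classical in
/-- The two weighings appended to a leaf with output `S` of a strong solution. -/
noncomputable def splitLeaf (S : Finset (Fin N)) : FCTree (3 * N) :=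
  if h₁ : ∃ a, S = {a} then splitOne h₁.choose
  else if h₂ : ∃ a b, a ≠ b ∧ S = {a, b} then splitTwo h₂.choose h₂.choose_spec.choose
  else .output ∅

theorem splitLeaf_singleton (a : Fin N) : splitLeaf {a} = splitOne a := by
  have h : ∃ a', ({a} : Finset (Fin N)) = {a'} := ⟨a, rfl⟩
  rw [splitLeaf, dif_pos h, ← Finset.singleton_inj.1 h.choose_spec]

theorem splitLeaf_induction {p : FCTree (3 * N) → Prop} (h₁ : ∀ a, p (splitOne a))
    (h₂ : ∀ a b, p (splitTwo a b)) (h₃ : p (.output ∅)) (S : Finset (Fin N)) :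
    p (splitLeaf S) := by
  unfold splitLeaf
  split_ifs
  exacts [h₁ _, h₂ _ _, h₃]

theorem wf_weighCoins {M : ℕ} {x y : Fin M} {l e g : FCTree M} (hxy : x ≠ y) (hl : l.WF)
    (he : e.WF) (hg : g.WF) : (weighCoins x y l e g).WF :=
  ⟨by simpa using hxy, by rintro (_ | _ | _) <;> assumption⟩

theorem balanced_weighCoins {M : ℕ} {x y : Fin M} {l e g : FCTree M} (hl : l.Balanced)
    (he : e.Balanced) (hg : g.Balanced) : (weighCoins x y l e g).Balanced :=
  ⟨by simp, by rintro (_ | _ | _) <;> assumption⟩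

theorem wf_splitLeaf (S : Finset (Fin N)) : (splitLeaf S).WF := by
  have hne (a : Fin N) {i j : Fin 3} (hij : i ≠ j) : groupCoin a i ≠ groupCoin a j := by
    simpa [groupCoin_inj] using hij
  refine splitLeaf_induction (fun a => ?_) (fun a b => ?_) trivial S <;>
    repeat' first | exact trivial | exact hne _ (by decide) | apply wf_weighCoins

theorem balanced_splitLeaf (S : Finset (Fin N)) : (splitLeaf S).Balanced := by
  refine splitLeaf_induction (fun a => ?_) (fun a b => ?_) trivial S <;>
    repeat' first | exact trivial | apply balanced_weighCoins

theorem depth_splitLeaf_le (S : Finset (Fin N)) : (splitLeaf S).depth ≤ 2 := by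
  refine splitLeaf_induction (p := fun t => t.depth ≤ 2) (fun a => ?_) (fun a b => ?_) ?_ S <;>
    simp [splitOne, splitTwo, selectPartner, weighCoins, FCTree.depth]

theorem splitLeaf_spec {f c : Fin (3 * N)} {T : Finset (Fin N)} {S : Finset (Fin (3 * N))}
    (hcard : T.card ≤ 2) (hmem : coinGroup f ∈ T)
    (hsingle : coinGroup c = coinGroup f → T = {coinGroup f})
    (h : Reaches f c (splitLeaf T) S) : S.card ≤ 2 ∧ f ∈ S ∧ (c = f → S = {f}) := by
  by_cases h₁ : ∃ a, T = {a}
  · obtain ⟨a, rfl⟩ := h₁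
    rw [splitLeaf_singleton, ← Finset.mem_singleton.1 hmem] at h
    exact splitOne_spec h
  have hc : coinGroup c ≠ coinGroup f := fun hc => h₁ ⟨_, hsingle hc⟩
  have h₂ : ∃ a b, a ≠ b ∧ T = {a, b} := by
    have hpos : 0 < T.card := Finset.card_pos.2 ⟨_, hmem⟩
    have hone : T.card ≠ 1 := fun hone => h₁ (Finset.card_eq_one.1 hone)
    exact Finset.card_eq_two.1 (by omega)
  rw [splitLeaf, dif_neg h₁, dif_pos h₂] at h
  obtain ⟨hne, hT⟩ := h₂.choose_spec.choose_spec
  have hf : coinGroup f = h₂.choose ∨ coinGroup f = h₂.choose_spec.choose := by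
    rw [hT] at hmem
    simpa using hmem
  obtain ⟨hS, hfS⟩ := splitTwo_spec hne hf hc h
  exact ⟨hS, hfS, fun hcf => absurd (congrArg coinGroup hcf) hc⟩

theorem IsStrongSolution.scaleExtend_splitLeaf {t : FCTree N} {w : ℕ}
    (ht : IsStrongSolution t w) : IsStrongSolution (scaleExtend splitLeaf t) (w + 2) := by
  have hspec {f c : Fin (3 * N)} {S : Finset (Fin (3 * N))}
      (h : Reaches f c (scaleExtend splitLeaf t) S) :
      S.card ≤ 2 ∧ f ∈ S ∧ (c = f → S = {f}) := by
    obtain ⟨T, hT, hS⟩ := exists_reaches_of_reaches_scaleExtend t ht.wf ht.balanced h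
    exact splitLeaf_spec (ht.card_le _ _ _ hT) (ht.mem _ _ _ hT)
      (fun hc => ht.eq_singleton _ _ (hc ▸ hT)) hS
  exact
    { wf := wf_scaleExtend wf_splitLeaf t ht.wf
      balanced := balanced_scaleExtend balanced_splitLeaf t ht.balanced
      depth_le := (depth_scaleExtend_le depth_splitLeaf_le t).trans (by have := ht.depth_le; omega)
      card_le := fun _ _ _ h => (hspec h).1
      mem := fun _ _ _ h => (hspec h).2.1
      eq_singleton := fun _ _ h => (hspec h).2.2 rfl }

end Scaling

/-- A strategy with pans given by the binary digits of natural numbers, children listed in the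
order left pan lighter, balance, right pan lighter, and outputs of the form `{i, j}`. -/
inductive MaskTree (N : ℕ) : Type
  | output (i j : Fin N) : MaskTree N
  | weigh (a b : ℕ) (l e g : MaskTree N) : MaskTree N

namespace MaskTree

variable {N : ℕ}

/-- The set of coins whose bit is set in `a`. -/
def pan (N a : ℕ) : Finset (Fin N) :=
  Finset.univ.filter fun x => a.testBit x.val = true

/-- The child belonging to an outcome. -/
def select {α : Type*} (l e g : α) : Ordering → α
  | .lt => l
  | .eq => e
  | .gt => g

/-- The strategy described by a mask tree. -/
def toFCTree : MaskTree N → FCTree N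
  | output i j => .output {i, j}
  | weigh a b l e g => .weigh (pan N a) (pan N b) (select l.toFCTree e.toFCTree g.toFCTree)

/-- Every weighing has disjoint pans of equal size, and there are at most `w` weighings. -/
def wellFormed : ℕ → MaskTree N → Bool
  | _, output _ _ => true
  | 0, weigh _ _ _ _ _ => false
  | w + 1, weigh a b l e g =>
      a &&& b == 0 && (pan N a).card == (pan N b).card &&
        (l.wellFormed w && (e.wellFormed w && g.wellFormed w))

/-- The total weight missing from the pan with mask `a`. -/
def maskDeficit (f c : Fin N) (b : Bool) (a : ℕ) : ℕ :=
  (a.testBit f.val).toNat + (c != f && (b && a.testBit c.val)).toNat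

/-- Every leaf that can be reached has a correct output. -/
def correct (f c : Fin N) : MaskTree N → Bool
  | output i j => (f == i || f == j) && (c != f || i == j)
  | weigh a b l e g => [false, true].all fun s =>
      select (l.correct f c) (e.correct f c) (g.correct f c)
        (compare (maskDeficit f c s b) (maskDeficit f c s a))

theorem maskDeficit_eq (f c : Fin N) (b : Bool) (a : ℕ) :
    maskDeficit f c b a = deficit f c b (pan N a) := by
  unfold maskDeficit deficit pan
  by_cases hc : c = f
  · subst hc
    cases hf : a.testBit c.val <;> simp [hf]
  · have hne : (c != f) = true := bne_iff_ne.2 hc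
    cases b <;> cases hf : a.testBit f.val <;> cases hc' : a.testBit c.val <;>
      simp [hc, hne, hf, hc']

theorem wf_toFCTree : ∀ {w : ℕ} {t : MaskTree N}, t.wellFormed w = true →
    t.toFCTree.WF ∧ t.toFCTree.Balanced ∧ t.toFCTree.depth ≤ w
  | _, output _ _, _ => ⟨trivial, trivial, Nat.zero_le _⟩
  | w + 1, weigh a b l e g, h => by
    simp only [wellFormed, Bool.and_eq_true, beq_iff_eq] at h
    obtain ⟨⟨hab, hcard⟩, hl, he, hg⟩ := h
    have hl := wf_toFCTree hl
    have he := wf_toFCTree he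
    have hg := wf_toFCTree hg
    refine ⟨⟨?_, ?_⟩, ⟨hcard, ?_⟩, ?_⟩
    · refine Finset.disjoint_left.2 fun x hxa hxb => ?_
      have hx := congrArg (Nat.testBit · x.val) hab
      simp only [pan, Finset.mem_filter] at hxa hxb
      simp [hxa.2, hxb.2] at hx
    · rintro (_ | _ | _)
      exacts [hl.1, he.1, hg.1]
    · rintro (_ | _ | _)
      exacts [hl.2.1, he.2.1, hg.2.1]
    · simp only [toFCTree, FCTree.depth, select]
      omega

theorem spec_of_correct {f c : Fin N} {S : Finset (Fin N)} :
    ∀ {w : ℕ} {t : MaskTree N}, t.wellFormed w = true → t.correct f c = true →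
      Reaches f c t.toFCTree S → S.card ≤ 2 ∧ f ∈ S ∧ (c = f → S = {f})
  | _, output i j, _, hcor, h => by
    rw [toFCTree, reaches_output_iff] at h
    subst h
    simp only [correct, Bool.and_eq_true, Bool.or_eq_true, beq_iff_eq, bne_iff_ne] at hcor
    refine ⟨Finset.card_le_two, by simpa using hcor.1, fun hc => ?_⟩
    obtain rfl := hcor.2.resolve_left (not_not.2 hc)
    obtain rfl : f = i := hcor.1.elim id id
    simp
  | w + 1, weigh a b l e g, hwf, hcor, h => by
    simp only [wellFormed, Bool.and_eq_true, beq_iff_eq] at hwf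
    obtain ⟨⟨-, hcard⟩, hl, he, hg⟩ := hwf
    rw [toFCTree, reaches_weigh_iff] at h
    obtain ⟨s, h⟩ := h
    rw [weighOutcome_eq_compare_deficit _ _ _ hcard] at h
    have hs := List.all_eq_true.1 hcor s (by cases s <;> simp)
    rw [maskDeficit_eq, maskDeficit_eq] at hs
    cases ho : compare (deficit f c s (pan N b)) (deficit f c s (pan N a)) <;>
      rw [ho] at h hs
    exacts [spec_of_correct hl hs h, spec_of_correct he hs h, spec_of_correct hg hs h]

theorem isStrongSolution_toFCTree {t : MaskTree N} {w : ℕ} (hwf : t.wellFormed w = true)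
    (hcor : ∀ f c, t.correct f c = true) : IsStrongSolution t.toFCTree w where
  wf := (wf_toFCTree hwf).1
  balanced := (wf_toFCTree hwf).2.1
  depth_le := (wf_toFCTree hwf).2.2
  card_le f c _ h := (spec_of_correct hwf (hcor f c) h).1
  mem f c _ h := (spec_of_correct hwf (hcor f c) h).2.1
  eq_singleton f _ h := (spec_of_correct hwf (hcor f f) h).2.2 rfl

/-- The remaining weighings for 20 coins when coins 0-5 were lighter than coins 6-11. -/
def twentyLeftLighter : MaskTree 20 :=
  .weigh 61440 983040
    (.weigh 4103 8248
      (.weigh 16384 32768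
        (.weigh 1 2 (.output 0 14) (.output 2 14) (.output 1 14))
        (.weigh 1 2 (.output 0 12) (.output 2 12) (.output 1 12))
        (.weigh 1 2 (.output 0 15) (.output 2 15) (.output 1 15)))
      (.weigh 49161 4146
        (.weigh 49152 8256 (.output 14 15) (.output 0 3) (.output 0 13))
        (.weigh 49152 4104 (.output 14 15) (.output 2 13) (.output 3 12))
        (.weigh 8194 17 (.output 1 13) (.output 5 12) (.output 4 12)))
      (.weigh 16384 32768
        (.weigh 8 16 (.output 3 14) (.output 5 14) (.output 4 14))
        (.weigh 8 16 (.output 3 13) (.output 5 13) (.output 4 13))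
        (.weigh 8 16 (.output 3 15) (.output 5 15) (.output 4 15))))
    (.weigh 7 56
      (.weigh 3 68
        (.weigh 1 2 (.output 0 0) (.output 0 1) (.output 1 1))
        (.weigh 5 10 (.output 0 2) (.output 1 2) (.output 1 1))
        (.output 2 2))
      (.weigh 1 2
        (.weigh 8 16 (.output 0 3) (.output 0 5) (.output 0 4))
        (.weigh 8 16 (.output 2 3) (.output 2 5) (.output 2 4))
        (.weigh 8 16 (.output 1 3) (.output 1 5) (.output 1 4)))
      (.weigh 24 96
        (.weigh 8 16 (.output 3 3) (.output 3 4) (.output 4 4))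
        (.weigh 40 17 (.output 3 5) (.output 4 5) (.output 4 4))
        (.output 5 5)))
    (.weigh 65543 131128
      (.weigh 262144 524288
        (.weigh 1 2 (.output 0 18) (.output 2 18) (.output 1 18))
        (.weigh 1 2 (.output 0 16) (.output 2 16) (.output 1 16))
        (.weigh 1 2 (.output 0 19) (.output 2 19) (.output 1 19)))
      (.weigh 786441 65586
        (.weigh 786432 131136 (.output 18 19) (.output 0 3) (.output 0 17))
        (.weigh 786432 65544 (.output 18 19) (.output 2 17) (.output 3 16))
        (.weigh 131074 17 (.output 1 17) (.output 5 16) (.output 4 16)))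
      (.weigh 262144 524288
        (.weigh 8 16 (.output 3 18) (.output 5 18) (.output 4 18))
        (.weigh 8 16 (.output 3 17) (.output 5 17) (.output 4 17))
        (.weigh 8 16 (.output 3 19) (.output 5 19) (.output 4 19))))

/-- The remaining weighings for 20 coins when coins 0-5 balanced coins 6-11. -/
def twentyBalance : MaskTree 20 :=
  .weigh 258048 786503
    (.weigh 28672 229376
      (.weigh 12288 16448
        (.weigh 4096 8192 (.output 12 12) (.output 12 13) (.output 13 13))
        (.weigh 20480 8193 (.output 12 14) (.output 13 14) (.output 13 13))
        (.output 14 14))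
      (.weigh 4096 8192
        (.weigh 32768 65536 (.output 12 15) (.output 12 17) (.output 12 16))
        (.weigh 32768 65536 (.output 14 15) (.output 14 17) (.output 14 16))
        (.weigh 32768 65536 (.output 13 15) (.output 13 17) (.output 13 16)))
      (.weigh 98304 131136
        (.weigh 32768 65536 (.output 15 15) (.output 15 16) (.output 16 16))
        (.weigh 163840 65537 (.output 15 17) (.output 16 17) (.output 16 16))
        (.output 17 17)))
    (.weigh 291200 755200
      (.weigh 290816 3712
        (.weigh 4096 8192 (.output 12 18) (.output 14 18) (.output 13 18))
        (.weigh 8 16 (.output 3 8) (.output 5 8) (.output 4 8))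
        (.weigh 8 16 (.output 3 7) (.output 5 7) (.output 4 7)))
      (.weigh 552960 491520
        (.weigh 4096 8192 (.output 12 19) (.output 14 19) (.output 13 19))
        (.weigh 8 16 (.output 3 11) (.output 5 11) (.output 4 11))
        (.weigh 32768 65536 (.output 15 18) (.output 17 18) (.output 16 18)))
      (.weigh 753664 2944
        (.weigh 32768 65536 (.output 15 19) (.output 17 19) (.output 16 19))
        (.weigh 8 16 (.output 3 10) (.output 5 10) (.output 4 10))
        (.weigh 8 16 (.output 3 9) (.output 5 9) (.output 4 9))))
    (.weigh 786616 29441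
      (.weigh 787200 120
        (.weigh 262144 524288 (.output 18 18) (.output 18 19) (.output 19 19))
        (.weigh 786432 258 (.output 18 19) (.output 2 7) (.output 1 7))
        (.weigh 8 16 (.output 3 6) (.output 5 6) (.output 4 6)))
      (.weigh 787587 231492
        (.weigh 786432 1026 (.output 18 19) (.output 0 7) (.output 1 10))
        (.weigh 1028 2056 (.output 2 10) (.output 1 6) (.output 1 11))
        (.weigh 2052 4160 (.output 2 11) (.output 2 6) (.output 6 6)))
      (.weigh 262 3584
        (.weigh 2 4 (.output 1 8) (.output 0 8) (.output 2 8))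
        (.weigh 10 65 (.output 1 9) (.output 2 9) (.output 0 6))
        (.weigh 1024 2048 (.output 0 10) (.output 0 9) (.output 0 11))))

/-- The remaining weighings for 20 coins when coins 0-5 were heavier than coins 6-11. -/
def twentyRightLighter : MaskTree 20 :=
  .weigh 61440 983040
    (.weigh 4544 11776
      (.weigh 16384 32768
        (.weigh 64 128 (.output 6 14) (.output 8 14) (.output 7 14))
        (.weigh 64 128 (.output 6 12) (.output 8 12) (.output 7 12))
        (.weigh 64 128 (.output 6 15) (.output 8 15) (.output 7 15)))
      (.weigh 49728 7296
        (.weigh 49152 8193 (.output 14 15) (.output 6 9) (.output 6 13))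
        (.weigh 49152 4608 (.output 14 15) (.output 8 13) (.output 9 12))
        (.weigh 8320 1088 (.output 7 13) (.output 11 12) (.output 10 12)))
      (.weigh 16384 32768
        (.weigh 512 1024 (.output 9 14) (.output 11 14) (.output 10 14))
        (.weigh 512 1024 (.output 9 13) (.output 11 13) (.output 10 13))
        (.weigh 512 1024 (.output 9 15) (.output 11 15) (.output 10 15))))
    (.weigh 448 3584
      (.weigh 192 257
        (.weigh 64 128 (.output 6 6) (.output 6 7) (.output 7 7))
        (.weigh 320 640 (.output 6 8) (.output 7 8) (.output 7 7))
        (.output 8 8))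
      (.weigh 64 128
        (.weigh 512 1024 (.output 6 9) (.output 6 11) (.output 6 10))
        (.weigh 512 1024 (.output 8 9) (.output 8 11) (.output 8 10))
        (.weigh 512 1024 (.output 7 9) (.output 7 11) (.output 7 10)))
      (.weigh 1536 2049
        (.weigh 512 1024 (.output 9 9) (.output 9 10) (.output 10 10))
        (.weigh 2560 1088 (.output 9 11) (.output 10 11) (.output 10 10))
        (.output 11 11)))
    (.weigh 65984 134656
      (.weigh 262144 524288
        (.weigh 64 128 (.output 6 18) (.output 8 18) (.output 7 18))
        (.weigh 64 128 (.output 6 16) (.output 8 16) (.output 7 16))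
        (.weigh 64 128 (.output 6 19) (.output 8 19) (.output 7 19)))
      (.weigh 787008 68736
        (.weigh 786432 131073 (.output 18 19) (.output 6 9) (.output 6 17))
        (.weigh 786432 66048 (.output 18 19) (.output 8 17) (.output 9 16))
        (.weigh 131200 1088 (.output 7 17) (.output 11 16) (.output 10 16)))
      (.weigh 262144 524288
        (.weigh 512 1024 (.output 9 18) (.output 11 18) (.output 10 18))
        (.weigh 512 1024 (.output 9 17) (.output 11 17) (.output 10 17))
        (.weigh 512 1024 (.output 9 19) (.output 11 19) (.output 10 19))))

/-- A strategy for 20 coins in five weighings. -/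
def twenty : MaskTree 20 :=
  .weigh 63 4032 twentyLeftLighter twentyBalance twentyRightLighter

theorem isStrongSolution_twenty : IsStrongSolution twenty.toFCTree 5 :=
  isStrongSolution_toFCTree (by decide +kernel) (by decide +kernel)

end MaskTree

theorem exists_isStrongSolution (k : ℕ) :
    ∃ t : FCTree (20 * 3 ^ k), IsStrongSolution t (5 + 2 * k) := by
  induction k with
  | zero => exact ⟨_, MaskTree.isStrongSolution_twenty⟩
  | succ k ih =>
    obtain ⟨t, ht⟩ := ih
    rw [show 20 * 3 ^ (k + 1) = 3 * (20 * 3 ^ k) by ring]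
    exact ⟨_, ht.scaleExtend_splitLeaf⟩

/-- For every integer k ≥ 1 there is an FC-algorithm in 5 + 2k weighings for
20·3^k coins, i.e. N(5+2k) ≥ 20·3^k. -/
theorem fc_N_odd_lower_bound (k : ℕ) (hk : 1 ≤ k) :
    FCAlgorithm (20 * 3 ^ k) (5 + 2 * k) := by
  obtain ⟨t, ht⟩ := exists_isStrongSolution k
  exact ⟨t, ht.isFCSolution⟩
end

section
/- Information-theoretic bound: if an FC-algorithm in w weighings for N coins exists, then N(N−1)/2 ≤ 3^w; equivalently, N(w) ≤ ⌊√(2·3^w + 1/4) + 1/2⌋ for every integer w ≥ 0. -/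
namespace FCTree

/-- The sets that a strategy may output. -/
def outputs {N : ℕ} : FCTree N → Finset (Finset (Fin N))
  | output S => {S}
  | weigh _ _ child => outputs (child .lt) ∪ (outputs (child .eq) ∪ outputs (child .gt))

theorem card_outputs_le {N : ℕ} (t : FCTree N) : t.outputs.card ≤ 3 ^ t.depth := by
  induction t with
  | output S => simp [outputs, depth]
  | weigh A B child ih =>
    set m := max (child .lt).depth (max (child .eq).depth (child .gt).depth) with hm
    have bound (o : Ordering) : (child o).outputs.card ≤ 3 ^ m := by
      refine (ih o).trans (Nat.pow_le_pow_right (by norm_num) ?_)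
      cases o <;> simp [hm]
    calc (weigh A B child).outputs.card
        ≤ (child .lt).outputs.card + ((child .eq).outputs.card + (child .gt).outputs.card) :=
          (Finset.card_union_le _ _).trans (Nat.add_le_add_left (Finset.card_union_le _ _) _)
      _ ≤ 3 ^ m + (3 ^ m + 3 ^ m) :=
          Nat.add_le_add (bound _) (Nat.add_le_add (bound _) (bound _))
      _ = 3 ^ (weigh A B child).depth := by rw [depth, ← hm]; ring

theorem ffRun_mem_outputs {N : ℕ} (f₁ f₂ : Fin N) (t : FCTree N) :
    ffRun f₁ f₂ t ∈ t.outputs := by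
  induction t with
  | output S => simp [ffRun, outputs]
  | weigh A B child ih =>
    simp only [ffRun, outputs, Finset.mem_union]
    generalize compare (∑ x ∈ A, ffWeight f₁ f₂ x) (∑ x ∈ B, ffWeight f₁ f₂ x) = o
    cases o <;> simp [ih]

end FCTree

theorem coinWeight_true {N : ℕ} (f c : Fin N) : coinWeight f c true = ffWeight f c := by
  funext x
  by_cases h₁ : x = f <;> by_cases h₂ : x = c <;> simp [coinWeight, ffWeight, h₁, h₂]

theorem ffRun_comm {N : ℕ} (f₁ f₂ : Fin N) (t : FCTree N) : ffRun f₁ f₂ t = ffRun f₂ f₁ t := by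
  have hw : ffWeight f₁ f₂ = ffWeight f₂ f₁ := by
    funext x
    simp [ffWeight, or_comm]
  induction t with
  | output S => rfl
  | weigh A B child ih => simp only [ffRun, hw, ih]

/-- A chameleon that always imitates the fake coin leads to the same output as two fake coins. -/
theorem reaches_ffRun {N : ℕ} (f c : Fin N) (t : FCTree N) : Reaches f c t (ffRun f c t) := by
  induction t with
  | output S => exact .output S
  | weigh A B child ih =>
    refine .weigh A B child true _ ?_
    simpa only [ffRun, weighOutcome, coinWeight_true] using ih _

theorem FCAlgorithm.ffAlgorithm {N w : ℕ} (h : FCAlgorithm N w) : FFAlgorithm N w := by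
  obtain ⟨t, hwf, hd, ht⟩ := h
  refine ⟨t, hwf, hd, fun f₁ f₂ hne => ?_⟩
  obtain ⟨hcard, h₁⟩ := ht f₁ f₂ hne _ (reaches_ffRun f₁ f₂ t)
  have h₂ := (ht f₂ f₁ hne.symm _ (reaches_ffRun f₂ f₁ t)).2
  rw [ffRun_comm] at h₂
  symm
  apply Finset.eq_of_subset_of_card_le
  · simp [Finset.insert_subset_iff, h₁, h₂]
  · rwa [Finset.card_pair hne]

theorem FFAlgorithm.choose_two_le {N w : ℕ} (h : FFAlgorithm N w) : N.choose 2 ≤ 3 ^ w := by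
  obtain ⟨t, -, hd, ht⟩ := h
  have hsub : Finset.powersetCard 2 (Finset.univ : Finset (Fin N)) ⊆ t.outputs := by
    intro S hS
    obtain ⟨f₁, f₂, hne, rfl⟩ := Finset.card_eq_two.1 (Finset.mem_powersetCard.1 hS).2
    rw [← ht f₁ f₂ hne]
    exact t.ffRun_mem_outputs f₁ f₂
  calc N.choose 2 = (Finset.powersetCard 2 (Finset.univ : Finset (Fin N))).card := by simp
    _ ≤ t.outputs.card := Finset.card_le_card hsub
    _ ≤ 3 ^ t.depth := t.card_outputs_le
    _ ≤ 3 ^ w := Nat.pow_le_pow_right (by norm_num) hd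

/-- Information-theoretic bound: if an FC-algorithm in w weighings for N coins
exists, then N(N−1)/2 ≤ 3^w; equivalently, N ≤ ⌊√(2·3^w + 1/4) + 1/2⌋. -/
theorem fc_information_theoretic_bound (N w : ℕ) (h : FCAlgorithm N w) :
    N * (N - 1) / 2 ≤ 3 ^ w ∧
    (N : ℤ) ≤ ⌊Real.sqrt (2 * (3 : ℝ) ^ w + 1 / 4) + 1 / 2⌋ := by
  have hc := h.ffAlgorithm.choose_two_le
  refine ⟨by rwa [← Nat.choose_two_right], ?_⟩
  have hr : (N : ℝ) * (N - 1) / 2 ≤ 3 ^ w := by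
    rw [← Nat.cast_choose_two]
    exact_mod_cast hc
  have hs : (N : ℝ) - 1 / 2 ≤ Real.sqrt (2 * (3 : ℝ) ^ w + 1 / 4) :=
    Real.le_sqrt_of_sq_le (by linarith)
  rw [Int.le_floor]
  push_cast
  linarith
end

section
/- For every integer n ≥ 1, there exists an FC-algorithm in 2n weighings for 3^n coins; that is, N(2n) ≥ 3^n. -/
namespace FCTree

/-- `SolvableOn P w` holds if some strategy with at most `w` weighings outputs a set of at most two
coins containing the fake coin `f`, for all `f` and chameleons `c` with `P f c`. -/
def SolvableOn {N : ℕ} (P : Fin N → Fin N → Prop) (w : ℕ) : Prop :=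
  ∃ t : FCTree N, t.WF ∧ t.depth ≤ w ∧
    ∀ f c : Fin N, f ≠ c → P f c → ∀ S, Reaches f c t S → S.card ≤ 2 ∧ f ∈ S

theorem SolvableOn.mono {N : ℕ} {P Q : Fin N → Fin N → Prop} {w : ℕ} (hP : SolvableOn P w)
    (h : ∀ f c, f ≠ c → Q f c → P f c) : SolvableOn Q w := by
  obtain ⟨t, hwf, hd, ht⟩ := hP
  exact ⟨t, hwf, hd, fun f c hfc hQ => ht f c hfc (h f c hfc hQ)⟩

theorem SolvableOn.of_output {N : ℕ} {P : Fin N → Fin N → Prop} (S : Finset (Fin N))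
    (hS : S.card ≤ 2) (h : ∀ f c, P f c → f ∈ S) (w : ℕ) : SolvableOn P w := by
  refine ⟨.output S, trivial, Nat.zero_le _, fun f c _ hP T hT => ?_⟩
  cases hT
  exact ⟨hS, h f c hP⟩

theorem SolvableOn.of_weigh {N : ℕ} {P : Fin N → Fin N → Prop} {w : ℕ} {A B : Finset (Fin N)}
    (hAB : Disjoint A B)
    (h : ∀ o, SolvableOn (fun f c => P f c ∧ ∃ b, weighOutcome f c b A B = o) w) :
    SolvableOn P (w + 1) := by
  choose t hwf hd ht using h
  refine ⟨.weigh A B t, ⟨hAB, hwf⟩, ?_, fun f c hfc hP S hS => ?_⟩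
  · have h₁ := hd .lt
    have h₂ := hd .eq
    have h₃ := hd .gt
    simp only [depth]
    omega
  · cases hS with
    | weigh _ _ _ b _ hS => exact ht _ f c hfc ⟨hP, b, rfl⟩ S hS

end FCTree

theorem sum_coinWeight_add {N : ℕ} {f c : Fin N} (hfc : f ≠ c) (b : Bool) (A : Finset (Fin N)) :
    ∑ x ∈ A, coinWeight f c b x + (if f ∈ A then 1 else 0) + (if c ∈ A ∧ b = true then 1 else 0)
      = A.card := by
  have hf : (if f ∈ A then 1 else 0) = ∑ x ∈ A, if x = f then 1 else 0 := by simp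
  have hc : (if c ∈ A ∧ b = true then 1 else 0)
      = ∑ x ∈ A, if x = c ∧ b = true then 1 else 0 := by
    cases b <;> simp
  rw [hf, hc, ← Finset.sum_add_distrib, ← Finset.sum_add_distrib, Finset.card_eq_sum_ones]
  refine Finset.sum_congr rfl fun x _ => ?_
  unfold coinWeight
  split_ifs <;> grind

/-- The number of coins in the pan `A` that weigh as fake. -/
def lightCount {N : ℕ} (f c : Fin N) (b : Bool) (A : Finset (Fin N)) : ℕ :=
  (if f ∈ A then 1 else 0) + (if c ∈ A ∧ b = true then 1 else 0)

/-- The outcome of weighing two pans with equally many coins compares the numbers of light coins. -/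
theorem weighOutcome_of_card_eq {N : ℕ} {f c : Fin N} (hfc : f ≠ c) (b : Bool)
    {A B : Finset (Fin N)} (hAB : A.card = B.card) :
    weighOutcome f c b A B = compare (lightCount f c b B) (lightCount f c b A) := by
  have hA := sum_coinWeight_add hfc b A
  have hB := sum_coinWeight_add hfc b B
  unfold weighOutcome lightCount
  rw [Nat.compare_eq_ite_lt, Nat.compare_eq_ite_lt]
  congr 1
  · apply propext; omega
  · congr 1; apply propext; omega

theorem Finset.exists_trisection {α : Type*} [DecidableEq α] {A : Finset α} {m : ℕ}
    (hA : A.card = 3 * m) :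
    ∃ A₁ A₂ A₃ : Finset α, A₁.card = m ∧ A₂.card = m ∧ A₃.card = m ∧
      Disjoint A₁ A₂ ∧ Disjoint A₁ A₃ ∧ Disjoint A₂ A₃ ∧ A₁ ∪ A₂ ∪ A₃ = A := by
  obtain ⟨A₁, h₁, hc₁⟩ := Finset.exists_subset_card_eq (s := A) (n := m) (by omega)
  have hd₁ := Finset.card_sdiff_of_subset h₁
  obtain ⟨A₂, h₂, hc₂⟩ := Finset.exists_subset_card_eq (s := A \ A₁) (n := m) (by omega)
  have hd₂ := Finset.card_sdiff_of_subset h₂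
  refine ⟨A₁, A₂, (A \ A₁) \ A₂, hc₁, hc₂, by omega, ?_, ?_, ?_, ?_⟩
  · exact Finset.disjoint_left.2 fun x hx hx' => (Finset.mem_sdiff.1 (h₂ hx')).2 hx
  · exact Finset.disjoint_left.2 fun x hx hx' =>
      (Finset.mem_sdiff.1 (Finset.mem_sdiff.1 hx').1).2 hx
  · exact Finset.disjoint_sdiff
  · rw [Finset.union_assoc, Finset.union_sdiff_of_subset h₂, Finset.union_sdiff_of_subset h₁]

/-- Weighing a third of `X` against another third tells which third contains the fake coin,
provided that the fake coin is in `X` and the chameleon is not. -/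
theorem exists_weighing_third {N : ℕ} {X : Finset (Fin N)} {m : ℕ} (hX : X.card = 3 * m) :
    ∃ (A B : Finset (Fin N)) (third : Ordering → Finset (Fin N)), Disjoint A B ∧
      (∀ o, (third o).card = m) ∧
      ∀ f c b, f ≠ c → f ∈ X → c ∉ X →
        f ∈ third (weighOutcome f c b A B) ∧ c ∉ third (weighOutcome f c b A B) := by
  obtain ⟨A, B, C, hA, hB, hC, hAB, hAC, hBC, rfl⟩ := Finset.exists_trisection hX
  refine ⟨A, B, fun | .lt => A | .eq => C | .gt => B, hAB, by rintro (_ | _ | _) <;> assumption,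
    fun f c b hfc hf hc => ?_⟩
  rw [weighOutcome_of_card_eq hfc b (hA.trans hB.symm)]
  rw [Finset.disjoint_left] at hAB hAC hBC
  rcases ho : compare (lightCount f c b B) (lightCount f c b A) <;>
    simp only [lightCount, compare_lt_iff_lt, compare_eq_iff_eq, compare_gt_iff_gt] at ho <;>
    grind

open FCTree

/-- If the fake coin is in one of two sets of `3 ^ k` coins that does not contain the chameleon,
then `2 * k` weighings suffice. -/
theorem solvableOn_pair {N : ℕ} (k : ℕ) (X Y : Finset (Fin N)) (hX : X.card = 3 ^ k)
    (hY : Y.card = 3 ^ k) :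
    SolvableOn (fun f c => f ∈ X ∧ c ∉ X ∨ f ∈ Y ∧ c ∉ Y) (2 * k) := by
  induction k generalizing X Y with
  | zero =>
    refine .of_output (X ∪ Y) ((Finset.card_union_le X Y).trans (by simp [hX, hY])) ?_ _
    rintro f c (h | h) <;> simp [h.1]
  | succ k ih =>
    obtain ⟨A, B, X', hAB, hX', hX⟩ := exists_weighing_third (hX.trans (pow_succ' 3 k))
    obtain ⟨C, D, Y', hCD, hY', hY⟩ := exists_weighing_third (hY.trans (pow_succ' 3 k))
    refine .of_weigh (w := 2 * k + 1) hAB fun o => .of_weigh hCD fun o' =>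
      (ih (X' o) (Y' o') (hX' o) (hY' o')).mono ?_
    rintro f c hfc ⟨⟨h, b, rfl⟩, b', rfl⟩
    exact h.imp (fun h => hX f c b hfc h.1 h.2) fun h => hY f c b' hfc h.1 h.2

/-- If the fake coin is in a given set of `3 ^ k` coins, then `2 * k` weighings suffice. -/
theorem solvableOn_mem {N : ℕ} (k : ℕ) (A : Finset (Fin N)) (hA : A.card = 3 ^ k) :
    SolvableOn (fun f _ => f ∈ A) (2 * k) := by
  induction k generalizing A with
  | zero => exact .of_output A (by simp [hA]) (fun _ _ h => h) _
  | succ k ih =>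
    obtain ⟨A₁, A₂, A₃, h₁, h₂, h₃, h₁₂, h₁₃, h₂₃, rfl⟩ :=
      Finset.exists_trisection (hA.trans (pow_succ' 3 k))
    rw [Finset.disjoint_left] at h₁₂ h₁₃ h₂₃
    have key {X Y : Finset (Fin N)} (hX : X.card = 3 ^ k) (hY : Y.card = 3 ^ k) {f c : Fin N}
        (hfc : f ≠ c) (b : Bool) := weighOutcome_of_card_eq hfc b (hX.trans hY.symm)
    refine .of_weigh (w := 2 * k + 1) (Finset.disjoint_left.2 h₁₂) fun
      | .lt => .of_weigh (Finset.disjoint_left.2 h₁₃) fun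
        | .lt => (ih A₁ h₁).mono ?_
        | .eq => (solvableOn_pair k A₁ A₃ h₁ h₃).mono ?_
        | .gt => (ih A₃ h₃).mono ?_
      | .eq => .of_weigh (Finset.disjoint_left.2 h₁₃) fun
        | .lt => (solvableOn_pair k A₁ A₂ h₁ h₂).mono ?_
        | .eq => (solvableOn_pair k A₂ A₃ h₂ h₃).mono ?_
        | .gt => (ih A₃ h₃).mono ?_
      | .gt => .of_weigh (Finset.disjoint_left.2 h₂₃) fun
        | .lt => (ih A₂ h₂).mono ?_
        | .eq => (solvableOn_pair k A₂ A₃ h₂ h₃).mono ?_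
        | .gt => (ih A₃ h₃).mono ?_
    all_goals
      rintro f c hfc ⟨⟨hf, b, ho⟩, b', ho'⟩
      simp only [key, h₁, h₂, h₃, hfc, ne_eq, not_false_eq_true, lightCount, compare_lt_iff_lt,
        compare_eq_iff_eq, compare_gt_iff_gt] at ho ho'
      grind

/-- For every integer n ≥ 1 there is an FC-algorithm in 2n weighings for 3^n
coins, i.e. N(2n) ≥ 3^n. -/
theorem fc_three_pow_in_two_n_weighings (n : ℕ) (hn : 1 ≤ n) :
    FCAlgorithm (3 ^ n) (2 * n) := by
  obtain ⟨t, hwf, hd, ht⟩ := solvableOn_mem n (Finset.univ : Finset (Fin (3 ^ n))) (by simp)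
  exact ⟨t, hwf, hd, fun f c hfc => ht f c hfc (Finset.mem_univ f)⟩
end

section
/- Induced bound from scalability (arithmetic form): let N ≥ 1 and w ≥ 0 be integers. If for every integer k ≥ 0 one has (N·3^k)(N·3^k − 1)/2 ≤ 3^(w+2k), then N^2 ≤ 2·3^w, i.e., N ≤ ⌊√(2·3^w)⌋. -/
/-- Induced bound from scalability (arithmetic form): if N ≥ 1 and for every
k ≥ 0 one has (N·3^k)(N·3^k − 1)/2 ≤ 3^(w+2k), then N² ≤ 2·3^w, i.e.
N ≤ ⌊√(2·3^w)⌋. -/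
theorem induced_bound_from_scalability (N w : ℕ) (hN : 1 ≤ N)
    (h : ∀ k : ℕ, (N * 3 ^ k) * (N * 3 ^ k - 1) / 2 ≤ 3 ^ (w + 2 * k)) :
    N ^ 2 ≤ 2 * 3 ^ w ∧ N ≤ Nat.sqrt (2 * 3 ^ w) := by
  have hsq : N ^ 2 ≤ 2 * 3 ^ w := by
    by_contra! hlt
    have hk := h N
    have hpow : N < 3 ^ N := Nat.lt_pow_self (by norm_num)
    have hsplit : 3 ^ (w + 2 * N) = 3 ^ w * (3 ^ N) ^ 2 := by
      rw [pow_add, mul_comm 2 N, pow_mul]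
    rw [hsplit] at hk
    generalize 3 ^ N = t at hk hpow
    generalize 3 ^ w = a at hk hlt
    obtain ⟨m, hm⟩ : ∃ m, N * t = m + 1 :=
      Nat.exists_eq_add_of_le' (Nat.mul_pos hN (by omega))
    rw [hm, Nat.add_sub_cancel] at hk
    have hbound : (m + 1) * m ≤ 2 * (a * t ^ 2) + 1 := by omega
    have hlower : (2 * a + 1) * t ^ 2 ≤ (m + 1) ^ 2 := by
      rw [← hm, mul_pow]
      exact Nat.mul_le_mul_right _ hlt
    nlinarith [Nat.mul_le_mul_right t hpow]
  exact ⟨hsq, Nat.le_sqrt'.mpr hsq⟩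
end
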